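/- Let Δ, a, b, c be integers with Δ ≥ 2, 1 ≤ a ≤ Δ-1, 0 ≤ b ≤ Δ-a-1 and 0 ≤ c ≤ Δ-a-1. Then none of the constant multisets consisting of Δ copies of M, Δ copies of P, or Δ copies of Z is a black configuration of Ψ_Δ(a,b,c). Consequently, since M occurs in the first white configuration of Ψ_Δ(a,b,c), P occurs in the second, and Z occurs in the third, every white configuration of Ψ_Δ(a,b,c) contains a label ℓ such that the multiset of Δ copies of ℓ is not a black configuration of Ψ_Δ(a,b,c). -/

import Mathlib

/-- The five-element alphabet {M, Z, P, O, X}. -/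
inductive Label5 where
  | M | Z | P | O | X
deriving DecidableEq

open Label5

/-- Black configurations of Ψ_Δ(a,b,c) (they only depend on Δ, a, c). -/
def blackPsi (Δ a c : ℕ) (w : Multiset Label5) : Prop :=
  (∃ s t u, w = s + (t ::ₘ u) ∧ Multiset.card s = a - 1 ∧ (t = M ∨ t = X) ∧
    Multiset.card u = Δ - a ∧ ∀ l ∈ u, l ∈ ({P, O, X} : Finset Label5)) ∨
  (∃ s t u, w = s + t + u ∧ Multiset.card s = a ∧
    Multiset.card t = c ∧ (∀ l ∈ t, l ∈ ({P, O, X} : Finset Label5)) ∧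
    Multiset.card u = Δ - a - c ∧ ∀ l ∈ u, l ∈ ({O, X} : Finset Label5)) ∨
  (∃ s u, w = s + (X ::ₘ u) ∧ Multiset.card s = a ∧
    Multiset.card u = Δ - a - 1 ∧ ∀ l ∈ u, l ∈ ({P, O, X} : Finset Label5))

/-- White configurations of Ψ_Δ(a,b,c) (they only depend on Δ, a, b). -/
def whitePsi (Δ a b : ℕ) (w : Multiset Label5) : Prop :=
  w = Multiset.replicate (a - 1) X + (M ::ₘ Multiset.replicate (Δ - a) O) ∨
  w = Multiset.replicate a X + Multiset.replicate b O +
        Multiset.replicate (Δ - a - b) P ∨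
  w = Multiset.replicate a X + (Z ::ₘ Multiset.replicate (Δ - a - 1) O)

/-- A constant multiset can be a black configuration only for the labels `O` and `X`. -/
theorem eq_O_or_X_of_blackPsi_replicate {Δ a c : ℕ} {l : Label5} (ha : a < Δ) (hc : c < Δ - a)
    (h : blackPsi Δ a c (Multiset.replicate Δ l)) : l = O ∨ l = X := by
  rcases h with ⟨s, t, u, hw, -, ht, hu, hul⟩ | ⟨s, t, u, hw, -, -, -, hu, hul⟩ | ⟨s, u, hw, -⟩
  · obtain ⟨x, hx⟩ := Multiset.card_pos_iff_exists_mem.mp (by omega : 0 < Multiset.card u)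
    have htl : t = l := Multiset.eq_of_mem_replicate (n := Δ) (hw ▸ by simp)
    have hxl : x = l := Multiset.eq_of_mem_replicate (n := Δ) (hw ▸ by simp [hx])
    have hmem := hul x hx
    subst htl hxl
    rcases ht with rfl | rfl <;> simp at hmem ⊢
  · obtain ⟨x, hx⟩ := Multiset.card_pos_iff_exists_mem.mp (by omega : 0 < Multiset.card u)
    have hxl : x = l := Multiset.eq_of_mem_replicate (n := Δ) (hw ▸ by simp [hx])
    simpa [hxl] using hul x hx
  · exact Or.inr (Multiset.eq_of_mem_replicate (n := Δ) (hw ▸ by simp)).symm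

theorem stmt3 (Δ a b c : ℕ) (hΔ : 2 ≤ Δ) (ha1 : 1 ≤ a) (ha2 : a ≤ Δ - 1)
    (hb : b ≤ Δ - a - 1) (hc : c ≤ Δ - a - 1) :
    ¬ blackPsi Δ a c (Multiset.replicate Δ M) ∧
    ¬ blackPsi Δ a c (Multiset.replicate Δ P) ∧
    ¬ blackPsi Δ a c (Multiset.replicate Δ Z) ∧
    ∀ w : Multiset Label5, whitePsi Δ a b w →
      ∃ l ∈ w, ¬ blackPsi Δ a c (Multiset.replicate Δ l) := by
  have key {l : Label5} (hO : l ≠ O) (hX : l ≠ X) :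
      ¬ blackPsi Δ a c (Multiset.replicate Δ l) := fun h =>
    (eq_O_or_X_of_blackPsi_replicate (by omega) (by omega) h).elim hO hX
  have hM := key (l := M) (by decide) (by decide)
  have hP := key (l := P) (by decide) (by decide)
  have hZ := key (l := Z) (by decide) (by decide)
  refine ⟨hM, hP, hZ, ?_⟩
  rintro w (rfl | rfl | rfl)
  · exact ⟨M, by simp, hM⟩
  · have hpos : Δ - a - b ≠ 0 := by omega
    exact ⟨P, Multiset.mem_add.mpr (Or.inr (Multiset.mem_replicate.mpr ⟨hpos, rfl⟩)), hP⟩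
  · exact ⟨Z, by simp, hZ⟩
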